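/- Let n ≥ 7 and let G be a bicyclic graph with n vertices. Then χ(G) ≤ (n−4)/2 + 1/√6 + 4/√5, with equality if and only if G is either obtained by joining two vertex-disjoint cycles C_a and C_b with a + b = n by an edge, or obtained from the cycle C_n by adding an edge; moreover, if G is not of either of these forms, then χ(G) ≤ (n−5)/2 + 6/√5, with equality if and only if G is either obtained by joining two vertex-disjoint cycles C_a and C_b with a + b < n by a path of length n − a − b + 1, or obtained by joining two non-adjacent vertices of a cycle C_a with 4 ≤ a ≤ n−1 by a path of length n − a + 1. -/

import Mathlib

open SimpleGraph

/-- The degree of a vertex (stated via `Set.ncard`, so no decidability assumptions). -/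
noncomputable def degR {V : Type*} (G : SimpleGraph V) (v : V) : ℕ :=
  (G.neighborSet v).ncard

/-- The sum-connectivity index `χ(G) = ∑_{uv ∈ E(G)} 1/√(d_G(u)+d_G(v))`. -/
noncomputable def sumConn {V : Type*} [Fintype V] (G : SimpleGraph V) : ℝ :=
  ∑ e ∈ G.edgeSet.toFinite.toFinset,
    Sym2.lift ⟨fun u v => (1 : ℝ) / Real.sqrt ((degR G u : ℝ) + (degR G v : ℝ)),
      fun u v => by simp [add_comm]⟩ e

/-- Two vertex-disjoint cycles `C_a` and `C_b` joined by an edge. -/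
def twoCyclesEdge (a b : ℕ) : SimpleGraph (Fin a ⊕ Fin b) :=
  SimpleGraph.fromRel (fun x y =>
    (∃ i j, x = Sum.inl i ∧ y = Sum.inl j ∧ (SimpleGraph.cycleGraph a).Adj i j) ∨
    (∃ i j, x = Sum.inr i ∧ y = Sum.inr j ∧ (SimpleGraph.cycleGraph b).Adj i j) ∨
    (∃ (ha : 0 < a) (hb : 0 < b), x = Sum.inl ⟨0, ha⟩ ∧ y = Sum.inr ⟨0, hb⟩))

/-- Two vertex-disjoint cycles `C_a` and `C_b` joined by a path with `k ≥ 1` internal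
vertices, i.e. a path of length `k + 1`. -/
def twoCyclesPath (a b k : ℕ) : SimpleGraph ((Fin a ⊕ Fin b) ⊕ Fin k) :=
  SimpleGraph.fromRel (fun x y =>
    (∃ i j, x = Sum.inl (Sum.inl i) ∧ y = Sum.inl (Sum.inl j) ∧
      (SimpleGraph.cycleGraph a).Adj i j) ∨
    (∃ i j, x = Sum.inl (Sum.inr i) ∧ y = Sum.inl (Sum.inr j) ∧
      (SimpleGraph.cycleGraph b).Adj i j) ∨
    (∃ (ha : 0 < a) (hk : 0 < k), x = Sum.inl (Sum.inl ⟨0, ha⟩) ∧ y = Sum.inr ⟨0, hk⟩) ∨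
    (∃ i j : Fin k, x = Sum.inr i ∧ y = Sum.inr j ∧ (j : ℕ) = (i : ℕ) + 1) ∨
    (∃ (hb : 0 < b) (hk : 0 < k),
      x = Sum.inr ⟨k - 1, Nat.sub_lt hk Nat.one_pos⟩ ∧ y = Sum.inl (Sum.inr ⟨0, hb⟩)))

/-- The cycle `C_a` together with a path with `k ≥ 1` internal vertices (i.e. a path of
length `k + 1`) joining the vertices `x` and `y` of the cycle. -/
def cyclePlusPath (a k : ℕ) (x y : Fin a) : SimpleGraph (Fin a ⊕ Fin k) :=
  SimpleGraph.fromRel (fun z w =>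
    (∃ i j, z = Sum.inl i ∧ w = Sum.inl j ∧ (SimpleGraph.cycleGraph a).Adj i j) ∨
    (∃ hk : 0 < k, z = Sum.inl x ∧ w = Sum.inr ⟨0, hk⟩) ∨
    (∃ i j : Fin k, z = Sum.inr i ∧ w = Sum.inr j ∧ (j : ℕ) = (i : ℕ) + 1) ∨
    (∃ hk : 0 < k, z = Sum.inr ⟨k - 1, Nat.sub_lt hk Nat.one_pos⟩ ∧ w = Sum.inl y))

/-- `G` belongs to the family `B₁⁽¹⁾(n)`: it is obtained by joining two vertex-disjoint
cycles `C_a` and `C_b` with `a + b = n` by an edge. -/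
def IsB1a {V : Type*} (n : ℕ) (G : SimpleGraph V) : Prop :=
  ∃ a b : ℕ, 3 ≤ a ∧ 3 ≤ b ∧ a + b = n ∧ Nonempty (G ≃g twoCyclesEdge a b)

/-- `G` belongs to the family `B₁⁽²⁾(n)`: it is obtained by joining two vertex-disjoint
cycles `C_a` and `C_b` with `a + b < n` by a path of length `n - a - b + 1`. -/
def IsB1b {V : Type*} (n : ℕ) (G : SimpleGraph V) : Prop :=
  ∃ a b : ℕ, 3 ≤ a ∧ 3 ≤ b ∧ a + b < n ∧ Nonempty (G ≃g twoCyclesPath a b (n - a - b))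

/-- `G` belongs to the family `B₃⁽¹⁾(n)`: it is obtained from the cycle `C_n` by adding
an edge (between two distinct non-adjacent vertices). -/
def IsB3a {V : Type*} (n : ℕ) (G : SimpleGraph V) : Prop :=
  ∃ x y : Fin n, x ≠ y ∧ ¬ (SimpleGraph.cycleGraph n).Adj x y ∧
    Nonempty (G ≃g (SimpleGraph.cycleGraph n ⊔ SimpleGraph.fromEdgeSet {s(x, y)}))

/-- `G` belongs to the family `B₃⁽²⁾(n)`: it is obtained by joining two non-adjacent
vertices of a cycle `C_a` with `4 ≤ a ≤ n - 1` by a path of length `n - a + 1`. -/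
def IsB3b {V : Type*} (n : ℕ) (G : SimpleGraph V) : Prop :=
  ∃ (a : ℕ) (x y : Fin a), 4 ≤ a ∧ a ≤ n - 1 ∧ x ≠ y ∧
    ¬ (SimpleGraph.cycleGraph a).Adj x y ∧ Nonempty (G ≃g cyclePlusPath a (n - a) x y)

section Degrees

variable {V W : Type*}

lemma degR_iso {G : SimpleGraph V} {M : SimpleGraph W} (f : G ≃g M) (v : V) :
    degR M (f v) = degR G v := by
  have : M.neighborSet (f v) = f '' G.neighborSet v := by
    ext w
    obtain ⟨w, rfl⟩ := f.surjective w
    simpa using f.map_adj_iff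
  rw [degR, degR, this, Set.ncard_image_of_injective _ f.injective]

lemma two_le_degR [Finite V] {G : SimpleGraph V} {v x y : V} (hx : G.Adj v x) (hy : G.Adj v y)
    (hxy : x ≠ y) : 2 ≤ degR G v := by
  rw [degR, ← Set.ncard_pair hxy]
  refine Set.ncard_le_ncard ?_
  rintro z (rfl | rfl) <;> assumption

lemma three_le_degR [Finite V] {G : SimpleGraph V} {v x y z : V} (hx : G.Adj v x)
    (hy : G.Adj v y) (hz : G.Adj v z) (hxy : x ≠ y) (hxz : x ≠ z) (hyz : y ≠ z) :
    3 ≤ degR G v := by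
  rw [degR, ← Set.ncard_eq_three.mpr ⟨x, y, z, hxy, hxz, hyz, rfl⟩]
  refine Set.ncard_le_ncard ?_
  rintro w (rfl | rfl | rfl) <;> assumption

/-- An injective homomorphism to a connected graph that does not increase degrees is an
isomorphism. -/
lemma nonempty_iso_of_injective_of_degR_le [Finite V] [Nonempty W] {G : SimpleGraph V}
    {M : SimpleGraph W} (hG : G.Connected) (φ : M →g G) (hφ : Function.Injective φ)
    (hdeg : ∀ x, degR G (φ x) ≤ degR M x) : Nonempty (G ≃g M) := by
  have key (x : W) : φ '' M.neighborSet x = G.neighborSet (φ x) := by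
    refine Set.eq_of_subset_of_ncard_le ?_ ?_
    · rintro _ ⟨y, hy, rfl⟩
      exact φ.map_adj hy
    · rw [Set.ncard_image_of_injective _ hφ]
      exact hdeg x
  have hsurj : Function.Surjective φ := by
    obtain ⟨x₀⟩ := ‹Nonempty W›
    have walk_mem {a b : V} (p : G.Walk a b) : a ∈ Set.range φ → b ∈ Set.range φ := by
      induction p with
      | nil => exact id
      | cons h _ ih =>
        rintro ⟨x, rfl⟩
        have h' : _ ∈ G.neighborSet (φ x) := h
        rw [← key x] at h'
        obtain ⟨y, -, hy⟩ := h'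
        exact ih ⟨y, hy⟩
    intro b
    obtain ⟨p⟩ := hG.preconnected (φ x₀) b
    exact walk_mem p ⟨x₀, rfl⟩
  refine ⟨(⟨Equiv.ofBijective φ ⟨hφ, hsurj⟩, ?_⟩ : M ≃g G).symm⟩
  intro x y
  refine ⟨fun h ↦ ?_, φ.map_adj⟩
  have h' : φ y ∈ G.neighborSet (φ x) := h
  rw [← key x] at h'
  obtain ⟨z, hz, hzy⟩ := h'
  exact hφ hzy ▸ hz

end Degrees

section CycleGraph

lemma cycleGraph_exists_adj_ne {a : ℕ} (ha : 3 ≤ a) (i : Fin a) :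
    ∃ x y, (cycleGraph a).Adj i x ∧ (cycleGraph a).Adj i y ∧ x ≠ y := by
  obtain ⟨m, rfl⟩ : ∃ m, a = m + 3 := ⟨a - 3, by omega⟩
  refine ⟨i - 1, i + 1, by simp [cycleGraph_adj], by simp [cycleGraph_adj], fun h ↦ ?_⟩
  have h2 := cycleGraph_degree_three_le (n := m) (v := i)
  rw [← card_neighborFinset_eq_degree, cycleGraph_neighborFinset, h] at h2
  simp at h2

lemma cycleGraph_adj_val {a : ℕ} {i j : Fin a} (h : (cycleGraph a).Adj i j) :
    (i : ℕ) + 1 = j ∨ (j : ℕ) + 1 = i ∨ ((i : ℕ) = 0 ∧ (j : ℕ) + 1 = a) ∨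
      ((j : ℕ) = 0 ∧ (i : ℕ) + 1 = a) := by
  rw [cycleGraph_adj'] at h
  rcases le_or_gt i j with hij | hij
  · rcases h with h | h
    · rcases hij.eq_or_lt with rfl | hlt
      · rw [Fin.sub_val_of_le le_rfl] at h; omega
      · rw [Fin.coe_sub_iff_lt.mpr hlt] at h; omega
    · rw [Fin.sub_val_of_le hij] at h; omega
  · rcases h with h | h
    · rw [Fin.sub_val_of_le hij.le] at h; omega
    · rw [Fin.coe_sub_iff_lt.mpr hij] at h; omega

lemma SimpleGraph.Walk.IsCycle.exists_hom_cycleGraph {V : Type*} {G : SimpleGraph V} {u : V}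
    {c : G.Walk u u} (hc : c.IsCycle) :
    ∃ φ : cycleGraph c.length →g G, Function.Injective φ ∧ (∀ h, φ ⟨0, h⟩ = u) ∧
      Set.range φ = {w | w ∈ c.support} := by
  have hlen := hc.three_le_length
  refine ⟨⟨fun i ↦ c.getVert i, ?_⟩, ?_, fun _ ↦ c.getVert_zero, ?_⟩
  · intro i j h
    have last {k : ℕ} (hk : k + 1 = c.length) : G.Adj (c.getVert k) (c.getVert 0) := by
      have := c.adj_getVert_succ (i := k) (by omega)
      rw [hk, c.getVert_length] at this
      rwa [c.getVert_zero]
    rcases cycleGraph_adj_val h with h | h | ⟨h, h'⟩ | ⟨h, h'⟩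
    · rw [← h]; exact c.adj_getVert_succ (by omega)
    · rw [← h]; exact (c.adj_getVert_succ (by omega)).symm
    · rw [h]; exact (last h').symm
    · rw [h]; exact last h'
  · intro i j h
    exact Fin.ext (hc.getVert_injOn' (by simp; omega) (by simp; omega) h)
  · ext w
    simp only [Set.mem_range, RelHom.coeFn_mk, Set.mem_ofPred_eq,
      Walk.mem_support_iff_exists_getVert]
    constructor
    · rintro ⟨i, rfl⟩
      exact ⟨i, rfl, i.2.le⟩
    · rintro ⟨i, rfl, hi⟩
      rcases hi.eq_or_lt with rfl | hi
      · exact ⟨⟨0, by omega⟩, by simp⟩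
      · exact ⟨⟨i, hi⟩, rfl⟩

/-- In a disjoint union of cycles, a non-isolated vertex lies on a copy of a cycle graph that
covers its connected component. -/
lemma SimpleGraph.IsCycles.exists_hom_cycleGraph {V : Type*} [Finite V] {H : SimpleGraph V}
    (hH : H.IsCycles) {u : V} (hu : (H.neighborSet u).Nonempty) :
    ∃ (a : ℕ) (ha : 3 ≤ a) (φ : cycleGraph a →g H), Function.Injective φ ∧
      φ ⟨0, by omega⟩ = u ∧ ∀ w, w ∈ Set.range φ ↔ H.Reachable w u := by
  obtain ⟨c, hc, hsupp⟩ := hH.exists_cycle_toSubgraph_verts_eq_connectedComponentSupp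
    (c := H.connectedComponentMk u) (v := u) rfl hu
  obtain ⟨φ, hφ, h0, hr⟩ := hc.exists_hom_cycleGraph
  refine ⟨c.length, hc.three_le_length, φ, hφ, h0 _, fun w ↦ ?_⟩
  rw [hr, Set.mem_ofPred_eq, ← Walk.mem_verts_toSubgraph, hsupp,
    ConnectedComponent.mem_supp_iff, ConnectedComponent.eq]

end CycleGraph

section Models

lemma twoCyclesEdge_adj_inl {a b : ℕ} {i j : Fin a} (h : (cycleGraph a).Adj i j) :
    (twoCyclesEdge a b).Adj (.inl i) (.inl j) := by
  rw [twoCyclesEdge, fromRel_adj]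
  exact ⟨by simpa using h.ne, .inl (.inl ⟨i, j, rfl, rfl, h⟩)⟩

lemma twoCyclesEdge_adj_inr {a b : ℕ} {i j : Fin b} (h : (cycleGraph b).Adj i j) :
    (twoCyclesEdge a b).Adj (.inr i) (.inr j) := by
  rw [twoCyclesEdge, fromRel_adj]
  exact ⟨by simpa using h.ne, .inl (.inr (.inl ⟨i, j, rfl, rfl, h⟩))⟩

lemma twoCyclesEdge_adj_inl_inr {a b : ℕ} (ha : 0 < a) (hb : 0 < b) :
    (twoCyclesEdge a b).Adj (.inl ⟨0, ha⟩) (.inr ⟨0, hb⟩) := by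
  rw [twoCyclesEdge, fromRel_adj]
  exact ⟨by simp, .inl (.inr (.inr ⟨ha, hb, rfl, rfl⟩))⟩

lemma two_le_degR_twoCyclesEdge {a b : ℕ} (ha : 3 ≤ a) (hb : 3 ≤ b) (w : Fin a ⊕ Fin b) :
    2 ≤ degR (twoCyclesEdge a b) w := by
  rcases w with i | i
  · obtain ⟨x, y, hx, hy, hxy⟩ := cycleGraph_exists_adj_ne ha i
    exact two_le_degR (twoCyclesEdge_adj_inl hx) (twoCyclesEdge_adj_inl hy) (by simpa)
  · obtain ⟨x, y, hx, hy, hxy⟩ := cycleGraph_exists_adj_ne hb i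
    exact two_le_degR (twoCyclesEdge_adj_inr hx) (twoCyclesEdge_adj_inr hy) (by simpa)

lemma three_le_degR_twoCyclesEdge_inl {a b : ℕ} (ha : 3 ≤ a) (hb : 3 ≤ b) :
    3 ≤ degR (twoCyclesEdge a b) (.inl ⟨0, by omega⟩) := by
  obtain ⟨x, y, hx, hy, hxy⟩ := cycleGraph_exists_adj_ne ha ⟨0, by omega⟩
  exact three_le_degR (twoCyclesEdge_adj_inl hx) (twoCyclesEdge_adj_inl hy)
    (twoCyclesEdge_adj_inl_inr _ (by omega)) (by simpa) (by simp) (by simp)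

lemma three_le_degR_twoCyclesEdge_inr {a b : ℕ} (ha : 3 ≤ a) (hb : 3 ≤ b) :
    3 ≤ degR (twoCyclesEdge a b) (.inr ⟨0, by omega⟩) := by
  obtain ⟨x, y, hx, hy, hxy⟩ := cycleGraph_exists_adj_ne hb ⟨0, by omega⟩
  exact three_le_degR (twoCyclesEdge_adj_inr hx) (twoCyclesEdge_adj_inr hy)
    (twoCyclesEdge_adj_inl_inr (by omega) _).symm (by simpa) (by simp) (by simp)

lemma two_le_degR_cycleGraph_sup {a : ℕ} (ha : 3 ≤ a) (x y w : Fin a) :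
    2 ≤ degR (cycleGraph a ⊔ fromEdgeSet {s(x, y)}) w := by
  obtain ⟨p, q, hp, hq, hpq⟩ := cycleGraph_exists_adj_ne ha w
  exact two_le_degR (.inl hp) (.inl hq) hpq

lemma three_le_degR_cycleGraph_sup {a : ℕ} (ha : 3 ≤ a) {x y : Fin a} (hxy : x ≠ y)
    (h : ¬ (cycleGraph a).Adj x y) :
    3 ≤ degR (cycleGraph a ⊔ fromEdgeSet {s(x, y)}) x := by
  obtain ⟨p, q, hp, hq, hpq⟩ := cycleGraph_exists_adj_ne ha x
  exact three_le_degR (.inl hp) (.inl hq) (z := y) (.inr (by simpa)) hpq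
    (by rintro rfl; exact h hp) (by rintro rfl; exact h hq)

lemma cyclePlusPath_adj_inl {a k : ℕ} {x y i j : Fin a} (h : (cycleGraph a).Adj i j) :
    (cyclePlusPath a k x y).Adj (.inl i) (.inl j) := by
  rw [cyclePlusPath, fromRel_adj]
  exact ⟨by simpa using h.ne, .inl (.inl ⟨i, j, rfl, rfl, h⟩)⟩

lemma cyclePlusPath_adj_start {a k : ℕ} {x y : Fin a} (hk : 0 < k) :
    (cyclePlusPath a k x y).Adj (.inl x) (.inr ⟨0, hk⟩) := by
  rw [cyclePlusPath, fromRel_adj]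
  exact ⟨by simp, .inl (.inr (.inl ⟨hk, rfl, rfl⟩))⟩

lemma cyclePlusPath_adj_inr {a k : ℕ} {x y : Fin a} {i j : Fin k} (h : (j : ℕ) = i + 1) :
    (cyclePlusPath a k x y).Adj (.inr i) (.inr j) := by
  rw [cyclePlusPath, fromRel_adj]
  exact ⟨by simp only [ne_eq, Sum.inr.injEq, Fin.ext_iff]; omega,
    .inl (.inr (.inr (.inl ⟨i, j, rfl, rfl, h⟩)))⟩

lemma cyclePlusPath_adj_end {a k : ℕ} {x y : Fin a} {i : Fin k} (h : (i : ℕ) + 1 = k) :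
    (cyclePlusPath a k x y).Adj (.inr i) (.inl y) := by
  rw [cyclePlusPath, fromRel_adj]
  exact ⟨by simp, .inl (.inr (.inr (.inr ⟨by omega, by simp [Fin.ext_iff]; omega, rfl⟩)))⟩

lemma not_cyclePlusPath_adj_inl {a k : ℕ} {x y i j : Fin a} (h : ¬ (cycleGraph a).Adj i j) :
    ¬ (cyclePlusPath a k x y).Adj (.inl i) (.inl j) := by
  have h' : ¬ (cycleGraph a).Adj j i := fun h' ↦ h h'.symm
  simp [cyclePlusPath, h, h']

lemma two_le_degR_cyclePlusPath {a k : ℕ} (ha : 3 ≤ a) {x y : Fin a} (hxy : x ≠ y)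
    (w : Fin a ⊕ Fin k) : 2 ≤ degR (cyclePlusPath a k x y) w := by
  rcases w with i | i
  · obtain ⟨p, q, hp, hq, hpq⟩ := cycleGraph_exists_adj_ne ha i
    exact two_le_degR (cyclePlusPath_adj_inl hp) (cyclePlusPath_adj_inl hq) (by simpa)
  · have prev : ∃ w, (cyclePlusPath a k x y).Adj (.inr i) w ∧
        (w = .inl x ∨ ∃ j : Fin k, w = .inr j ∧ j < i) := by
      by_cases hi : (i : ℕ) = 0
      · have hi' : i = ⟨0, by omega⟩ := Fin.ext hi
        exact ⟨.inl x, by rw [hi']; exact (cyclePlusPath_adj_start _).symm, .inl rfl⟩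
      · have hj : (i : ℕ) = (⟨i - 1, by omega⟩ : Fin k) + 1 := by simp; omega
        exact ⟨_, (cyclePlusPath_adj_inr hj).symm, .inr ⟨_, rfl, by
          rw [Fin.lt_def]; simp; omega⟩⟩
    have next : ∃ w, (cyclePlusPath a k x y).Adj (.inr i) w ∧
        (w = .inl y ∨ ∃ j : Fin k, w = .inr j ∧ i < j) := by
      by_cases hi : (i : ℕ) + 1 = k
      · exact ⟨_, cyclePlusPath_adj_end hi, .inl rfl⟩
      · exact ⟨_, cyclePlusPath_adj_inr (j := ⟨i + 1, by omega⟩) rfl, .inr ⟨_, rfl, by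
          rw [Fin.lt_def]; simp⟩⟩
    obtain ⟨p, hp, hp'⟩ := prev
    obtain ⟨q, hq, hq'⟩ := next
    refine two_le_degR hp hq ?_
    rcases hp' with rfl | ⟨j, rfl, hj⟩ <;> rcases hq' with rfl | ⟨j', rfl, hj'⟩
    · simpa
    · simp
    · simp
    · simpa using (hj.trans hj').ne

lemma three_le_degR_cyclePlusPath_start {a k : ℕ} (ha : 3 ≤ a) (hk : 0 < k) (x y : Fin a) :
    3 ≤ degR (cyclePlusPath a k x y) (.inl x) := by
  obtain ⟨p, q, hp, hq, hpq⟩ := cycleGraph_exists_adj_ne ha x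
  exact three_le_degR (cyclePlusPath_adj_inl hp) (cyclePlusPath_adj_inl hq)
    (cyclePlusPath_adj_start hk) (by simpa) (by simp) (by simp)

lemma three_le_degR_cyclePlusPath_end {a k : ℕ} (ha : 3 ≤ a) (hk : 0 < k) (x y : Fin a) :
    3 ≤ degR (cyclePlusPath a k x y) (.inl y) := by
  obtain ⟨p, q, hp, hq, hpq⟩ := cycleGraph_exists_adj_ne ha y
  exact three_le_degR (cyclePlusPath_adj_inl hp) (cyclePlusPath_adj_inl hq)
    (cyclePlusPath_adj_end (i := ⟨k - 1, by omega⟩) (by simp; omega)).symm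
    (by simpa) (by simp) (by simp)

lemma twoCyclesPath_adj_left {a b k : ℕ} {i j : Fin a} (h : (cycleGraph a).Adj i j) :
    (twoCyclesPath a b k).Adj (.inl (.inl i)) (.inl (.inl j)) := by
  rw [twoCyclesPath, fromRel_adj]
  exact ⟨by simpa using h.ne, .inl (.inl ⟨i, j, rfl, rfl, h⟩)⟩

lemma twoCyclesPath_adj_right {a b k : ℕ} {i j : Fin b} (h : (cycleGraph b).Adj i j) :
    (twoCyclesPath a b k).Adj (.inl (.inr i)) (.inl (.inr j)) := by
  rw [twoCyclesPath, fromRel_adj]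
  exact ⟨by simpa using h.ne, .inl (.inr (.inl ⟨i, j, rfl, rfl, h⟩))⟩

lemma twoCyclesPath_adj_start {a b k : ℕ} (ha : 0 < a) (hk : 0 < k) :
    (twoCyclesPath a b k).Adj (.inl (.inl ⟨0, ha⟩)) (.inr ⟨0, hk⟩) := by
  rw [twoCyclesPath, fromRel_adj]
  exact ⟨by simp, .inl (.inr (.inr (.inl ⟨ha, hk, rfl, rfl⟩)))⟩

lemma twoCyclesPath_adj_inr {a b k : ℕ} {i j : Fin k} (h : (j : ℕ) = i + 1) :
    (twoCyclesPath a b k).Adj (.inr i) (.inr j) := by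
  rw [twoCyclesPath, fromRel_adj]
  exact ⟨by simp only [ne_eq, Sum.inr.injEq, Fin.ext_iff]; omega,
    .inl (.inr (.inr (.inr (.inl ⟨i, j, rfl, rfl, h⟩))))⟩

lemma twoCyclesPath_adj_end {a b k : ℕ} (hb : 0 < b) {i : Fin k} (h : (i : ℕ) + 1 = k) :
    (twoCyclesPath a b k).Adj (.inr i) (.inl (.inr ⟨0, hb⟩)) := by
  rw [twoCyclesPath, fromRel_adj]
  exact ⟨by simp,
    .inl (.inr (.inr (.inr (.inr ⟨hb, by omega, by simp [Fin.ext_iff]; omega, rfl⟩))))⟩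

lemma not_twoCyclesPath_adj {a b k : ℕ} (i : Fin a) (j : Fin b) :
    ¬ (twoCyclesPath a b k).Adj (.inl (.inl i)) (.inl (.inr j)) := by
  simp [twoCyclesPath]

lemma two_le_degR_twoCyclesPath {a b k : ℕ} (ha : 3 ≤ a) (hb : 3 ≤ b)
    (w : (Fin a ⊕ Fin b) ⊕ Fin k) : 2 ≤ degR (twoCyclesPath a b k) w := by
  rcases w with (i | i) | i
  · obtain ⟨p, q, hp, hq, hpq⟩ := cycleGraph_exists_adj_ne ha i
    exact two_le_degR (twoCyclesPath_adj_left hp) (twoCyclesPath_adj_left hq) (by simpa)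
  · obtain ⟨p, q, hp, hq, hpq⟩ := cycleGraph_exists_adj_ne hb i
    exact two_le_degR (twoCyclesPath_adj_right hp) (twoCyclesPath_adj_right hq) (by simpa)
  · have prev : ∃ w, (twoCyclesPath a b k).Adj (.inr i) w ∧
        ((∃ j, w = .inl (.inl j)) ∨ ∃ j : Fin k, w = .inr j ∧ j < i) := by
      by_cases hi : (i : ℕ) = 0
      · have hi' : i = ⟨0, by omega⟩ := Fin.ext hi
        have ha' : 0 < a := by omega
        exact ⟨.inl (.inl ⟨0, ha'⟩), by
          rw [hi']; exact (twoCyclesPath_adj_start _ _).symm, .inl ⟨_, rfl⟩⟩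
      · have hj : (i : ℕ) = (⟨i - 1, by omega⟩ : Fin k) + 1 := by simp; omega
        exact ⟨_, (twoCyclesPath_adj_inr hj).symm, .inr ⟨_, rfl, by
          rw [Fin.lt_def]; simp; omega⟩⟩
    have next : ∃ w, (twoCyclesPath a b k).Adj (.inr i) w ∧
        ((∃ j, w = .inl (.inr j)) ∨ ∃ j : Fin k, w = .inr j ∧ i < j) := by
      by_cases hi : (i : ℕ) + 1 = k
      · exact ⟨_, twoCyclesPath_adj_end (by omega) hi, .inl ⟨_, rfl⟩⟩
      · exact ⟨_, twoCyclesPath_adj_inr (j := ⟨i + 1, by omega⟩) rfl, .inr ⟨_, rfl, by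
          rw [Fin.lt_def]; simp⟩⟩
    obtain ⟨p, hp, hp'⟩ := prev
    obtain ⟨q, hq, hq'⟩ := next
    refine two_le_degR hp hq ?_
    rcases hp' with ⟨j, rfl⟩ | ⟨j, rfl, hj⟩ <;> rcases hq' with ⟨j', rfl⟩ | ⟨j', rfl, hj'⟩
    · simp
    · simp
    · simp
    · simpa using (hj.trans hj').ne

lemma three_le_degR_twoCyclesPath_left {a b k : ℕ} (ha : 3 ≤ a) (hk : 0 < k) :
    3 ≤ degR (twoCyclesPath a b k) (.inl (.inl ⟨0, by omega⟩)) := by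
  obtain ⟨p, q, hp, hq, hpq⟩ := cycleGraph_exists_adj_ne ha ⟨0, by omega⟩
  exact three_le_degR (twoCyclesPath_adj_left hp) (twoCyclesPath_adj_left hq)
    (twoCyclesPath_adj_start _ hk) (by simpa) (by simp) (by simp)

lemma three_le_degR_twoCyclesPath_right {a b k : ℕ} (hb : 3 ≤ b) (hk : 0 < k) :
    3 ≤ degR (twoCyclesPath a b k) (.inl (.inr ⟨0, by omega⟩)) := by
  obtain ⟨p, q, hp, hq, hpq⟩ := cycleGraph_exists_adj_ne hb ⟨0, by omega⟩
  exact three_le_degR (twoCyclesPath_adj_right hp) (twoCyclesPath_adj_right hq)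
    (twoCyclesPath_adj_end _ (i := ⟨k - 1, by omega⟩) (by simp; omega)).symm
    (by simpa) (by simp) (by simp)

end Models

section BranchVertices

variable {V : Type*} {G : SimpleGraph V} {n : ℕ}

lemma exists_branch_of_iso {W : Type*} {M : SimpleGraph W} (f : G ≃g M) {x y : W} (hxy : x ≠ y)
    (h2 : ∀ w, 2 ≤ degR M w) (hx : 3 ≤ degR M x) (hy : 3 ≤ degR M y) :
    ∃ u v, f u = x ∧ f v = y ∧ u ≠ v ∧ (∀ w, 2 ≤ degR G w) ∧ 3 ≤ degR G u ∧ 3 ≤ degR G v := by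
  obtain ⟨u, rfl⟩ := f.surjective x
  obtain ⟨v, rfl⟩ := f.surjective y
  simp only [degR_iso] at hx hy
  exact ⟨u, v, rfl, rfl, fun h ↦ hxy (h ▸ rfl), fun w ↦ degR_iso f w ▸ h2 _, hx, hy⟩

lemma exists_adj_branch_of_isB1a_or_isB3a (hn : 3 ≤ n) (h : IsB1a n G ∨ IsB3a n G) :
    ∃ u v, G.Adj u v ∧ u ≠ v ∧ (∀ w, 2 ≤ degR G w) ∧ 3 ≤ degR G u ∧ 3 ≤ degR G v := by
  rcases h with ⟨a, b, ha, hb, -, ⟨f⟩⟩ | ⟨x, y, hxy, hadj, ⟨f⟩⟩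
  · obtain ⟨u, v, hu, hv, h⟩ := exists_branch_of_iso f (by simp)
      (two_le_degR_twoCyclesEdge ha hb) (three_le_degR_twoCyclesEdge_inl ha hb)
      (three_le_degR_twoCyclesEdge_inr ha hb)
    refine ⟨u, v, ?_, h⟩
    rw [← f.map_adj_iff, hu, hv]
    exact twoCyclesEdge_adj_inl_inr _ _
  · have hy := three_le_degR_cycleGraph_sup hn hxy.symm (fun h ↦ hadj h.symm)
    rw [Sym2.eq_swap] at hy
    obtain ⟨u, v, hu, hv, h⟩ := exists_branch_of_iso f hxy
      (two_le_degR_cycleGraph_sup hn x y) (three_le_degR_cycleGraph_sup hn hxy hadj) hy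
    refine ⟨u, v, ?_, h⟩
    rw [← f.map_adj_iff, hu, hv]
    simp [hxy]

lemma exists_not_adj_branch_of_isB1b_or_isB3b (hn : 1 ≤ n) (h : IsB1b n G ∨ IsB3b n G) :
    ∃ u v, ¬ G.Adj u v ∧ u ≠ v ∧ (∀ w, 2 ≤ degR G w) ∧ 3 ≤ degR G u ∧ 3 ≤ degR G v := by
  rcases h with ⟨a, b, ha, hb, hlt, ⟨f⟩⟩ | ⟨a, x, y, ha, han, hxy, hadj, ⟨f⟩⟩
  · obtain ⟨u, v, hu, hv, h⟩ := exists_branch_of_iso f (by simp)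
      (two_le_degR_twoCyclesPath ha hb) (three_le_degR_twoCyclesPath_left ha (by omega))
      (three_le_degR_twoCyclesPath_right hb (by omega))
    refine ⟨u, v, ?_, h⟩
    rw [← f.map_adj_iff, hu, hv]
    exact not_twoCyclesPath_adj _ _
  · obtain ⟨u, v, hu, hv, h⟩ := exists_branch_of_iso f (by simpa)
      (two_le_degR_cyclePlusPath (by omega) hxy)
      (three_le_degR_cyclePlusPath_start (by omega) (by omega) x y)
      (three_le_degR_cyclePlusPath_end (by omega) (by omega) x y)
    refine ⟨u, v, ?_, h⟩
    rw [← f.map_adj_iff, hu, hv]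
    exact not_cyclePlusPath_adj_inl hadj

lemma degR_le_of_branch {W : Type*} {M : SimpleGraph W} {φ : W → V}
    {x y : W}
    (hφ : Function.Injective φ) (hw : ∀ w, w ≠ φ x → w ≠ φ y → degR G w = 2)
    (hu : degR G (φ x) = 3) (hv : degR G (φ y) = 3) (h2 : ∀ w, 2 ≤ degR M w)
    (hx : 3 ≤ degR M x) (hy : 3 ≤ degR M y) (w : W) : degR G (φ w) ≤ degR M w := by
  by_cases hwx : w = x
  · rwa [hwx, hu]
  by_cases hwy : w = y
  · rwa [hwy, hv]
  rw [hw _ (hφ.ne hwx) (hφ.ne hwy)]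
  exact h2 w

end BranchVertices

section Structure

variable {V : Type*} [Finite V] {G : SimpleGraph V} {u v : V}

lemma degR_sdiff_toSubgraph {a b : V} (p : G.Walk a b) (w : V) :
    ((G \ p.toSubgraph.spanningCoe).neighborSet w).ncard =
      degR G w - (p.toSubgraph.neighborSet w).ncard := by
  have : (G \ p.toSubgraph.spanningCoe).neighborSet w =
      G.neighborSet w \ p.toSubgraph.neighborSet w := by
    ext x; simp
  rw [this, degR, Set.ncard_sdiff (p.toSubgraph.neighborSet_subset w)]

lemma isCycles_sdiff_toSubgraph {p : G.Walk u v} (hp : p.IsPath) (huv : u ≠ v)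
    (hu : degR G u = 3) (hv : degR G v = 3) (hw : ∀ w, w ≠ u → w ≠ v → degR G w = 2) :
    (G \ p.toSubgraph.spanningCoe).IsCycles ∧
      ((G \ p.toSubgraph.spanningCoe).neighborSet u).Nonempty ∧
      ((G \ p.toSubgraph.spanningCoe).neighborSet v).Nonempty ∧
      ∀ j, 0 < j → j < p.length →
        (G \ p.toSubgraph.spanningCoe).neighborSet (p.getVert j) = ∅ := by
  have hnil : ¬ p.Nil := Walk.not_nil_of_ne huv
  have hu' : ((G \ p.toSubgraph.spanningCoe).neighborSet u).ncard = 2 := by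
    rw [degR_sdiff_toSubgraph, hp.neighborSet_toSubgraph_startpoint hnil, hu,
      Set.ncard_singleton]
  have hv' : ((G \ p.toSubgraph.spanningCoe).neighborSet v).ncard = 2 := by
    rw [degR_sdiff_toSubgraph, hp.neighborSet_toSubgraph_endpoint hnil, hv,
      Set.ncard_singleton]
  have hint (j : ℕ) (h0 : 0 < j) (hj : j < p.length) :
      (G \ p.toSubgraph.spanningCoe).neighborSet (p.getVert j) = ∅ := by
    rw [← Set.ncard_eq_zero, degR_sdiff_toSubgraph,
      hp.ncard_neighborSet_toSubgraph_internal_eq_two h0.ne' hj, hw]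
    · rw [Ne, hp.getVert_eq_start_iff hj.le]; omega
    · rw [Ne, hp.getVert_eq_end_iff hj.le]; omega
  refine ⟨fun w hne ↦ ?_, Set.nonempty_of_ncard_ne_zero (by omega),
    Set.nonempty_of_ncard_ne_zero (by omega), hint⟩
  by_cases hwu : w = u
  · rwa [hwu]
  by_cases hwv : w = v
  · rwa [hwv]
  have hps : w ∉ p.support := by
    rw [Walk.mem_support_iff_exists_getVert]
    rintro ⟨j, rfl, hj⟩
    have h0 : j ≠ 0 := by rintro rfl; exact hwu p.getVert_zero
    have hl : j ≠ p.length := by rintro rfl; exact hwv p.getVert_length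
    exact hne.ne_empty (hint j (by omega) (by omega))
  have : p.toSubgraph.neighborSet w = ∅ := by
    rw [Set.eq_empty_iff_forall_notMem]
    exact fun x hx ↦ hps (p.mem_verts_toSubgraph.mp hx.fst_mem)
  rw [degR_sdiff_toSubgraph, this, Set.ncard_empty, hw w hwu hwv]

/-- A path `p` between the two branch vertices of a graph is completed by one cycle through both
of them, or by two disjoint cycles through one of them each. -/
lemma exists_cycles_of_isPath {p : G.Walk u v} (hp : p.IsPath) (huv : u ≠ v)
    (hu : degR G u = 3) (hv : degR G v = 3) (hw : ∀ w, w ≠ u → w ≠ v → degR G w = 2)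
    (hadj : ¬ (G \ p.toSubgraph.spanningCoe).Adj u v) :
    ∃ (a : ℕ) (ha : 3 ≤ a) (φ : cycleGraph a →g G), Function.Injective φ ∧
      φ ⟨0, by omega⟩ = u ∧ (∀ i j, 0 < j → j < p.length → φ i ≠ p.getVert j) ∧
      ((∃ y, φ y = v ∧ ¬ (cycleGraph a).Adj ⟨0, by omega⟩ y) ∨
        ∃ (b : ℕ) (hb : 3 ≤ b) (ψ : cycleGraph b →g G), Function.Injective ψ ∧
          ψ ⟨0, by omega⟩ = v ∧ (∀ i j, 0 < j → j < p.length → ψ i ≠ p.getVert j) ∧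
          ∀ i j, φ i ≠ ψ j) := by
  obtain ⟨hcyc, hnu, hnv, hint⟩ := isCycles_sdiff_toSubgraph hp huv hu hv hw
  set H := G \ p.toSubgraph.spanningCoe
  have hHG : H ≤ G := sdiff_le
  have avoid {a : ℕ} (ha : 3 ≤ a) (φ : cycleGraph a →g H) (i : Fin a) (j : ℕ) (h0 : 0 < j)
      (hj : j < p.length) : φ i ≠ p.getVert j := by
    intro h
    obtain ⟨x, -, hx, -⟩ := cycleGraph_exists_adj_ne ha i
    have hx' : φ x ∈ H.neighborSet (p.getVert j) := h ▸ φ.map_adj hx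
    rw [hint j h0 hj] at hx'
    exact hx'
  obtain ⟨a, ha, φ, hφ, hφ0, hφr⟩ := hcyc.exists_hom_cycleGraph hnu
  refine ⟨a, ha, (Hom.ofLE hHG).comp φ, hφ, hφ0, avoid ha φ, ?_⟩
  by_cases hr : H.Reachable v u
  · obtain ⟨y, hy⟩ := (hφr v).mpr hr
    refine .inl ⟨y, hy, fun h ↦ hadj ?_⟩
    rw [← hφ0, ← hy]
    exact φ.map_adj h
  · obtain ⟨b, hb, ψ, hψ, hψ0, hψr⟩ := hcyc.exists_hom_cycleGraph hnv
    refine .inr ⟨b, hb, (Hom.ofLE hHG).comp ψ, hψ, hψ0, avoid hb ψ, fun i j h ↦ hr ?_⟩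
    exact ((hψr _).mp ⟨j, rfl⟩).symm.trans ((hφr (ψ j)).mp ⟨i, h⟩)

lemma isB1a_or_isB3a_of_adj (hG : G.Connected) (huv : G.Adj u v)
    (hu : degR G u = 3) (hv : degR G v = 3) (hw : ∀ w, w ≠ u → w ≠ v → degR G w = 2) :
    IsB1a (Nat.card V) G ∨ IsB3a (Nat.card V) G := by
  have hp : (huv.toWalk).IsPath := by simp [Adj.toWalk, huv.ne]
  obtain ⟨a, ha, φ, hφ, hφ0, -, h⟩ := exists_cycles_of_isPath hp huv.ne hu hv hw
    (by simp [huv.ne])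
  have ha0 : 0 < a := by omega
  replace hφ0 : φ ⟨0, ha0⟩ = u := hφ0
  rcases h with ⟨y, rfl, hy⟩ | ⟨b, hb, ψ, hψ, hψ0, -, hφψ⟩
  · right
    replace hy : ¬ (cycleGraph a).Adj ⟨0, ha0⟩ y := hy
    subst hφ0
    have hne : (⟨0, by omega⟩ : Fin a) ≠ y := fun h ↦ huv.ne (congrArg φ h)
    have h3 := three_le_degR_cycleGraph_sup ha hne.symm (fun h ↦ hy h.symm)
    rw [Sym2.eq_swap] at h3
    have : Nonempty (Fin a) := ⟨y⟩
    let Φ : cycleGraph a ⊔ fromEdgeSet {s(⟨0, by omega⟩, y)} →g G := ⟨φ, by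
      rintro i j (h | h)
      · exact φ.map_adj h
      · simp only [fromEdgeSet_adj, Set.mem_singleton_iff, Sym2.eq_iff] at h
        rcases h.1 with ⟨rfl, rfl⟩ | ⟨rfl, rfl⟩
        · exact huv
        · exact huv.symm⟩
    obtain ⟨f⟩ := nonempty_iso_of_injective_of_degR_le hG Φ hφ
      (degR_le_of_branch hφ hw hu hv (two_le_degR_cycleGraph_sup ha _ y)
        (three_le_degR_cycleGraph_sup ha hne hy) h3)
    obtain rfl : a = Nat.card V := by rw [Nat.card_congr f.toEquiv, Nat.card_fin]
    exact ⟨_, y, hne, hy, ⟨f⟩⟩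
  · left
    have hb0 : 0 < b := by omega
    replace hψ0 : ψ ⟨0, hb0⟩ = v := hψ0
    subst hφ0 hψ0
    have : Nonempty (Fin a ⊕ Fin b) := ⟨.inl ⟨0, by omega⟩⟩
    have hinj : Function.Injective (Sum.elim φ ψ) := hφ.sumElim hψ hφψ
    let Φ : twoCyclesEdge a b →g G := ⟨Sum.elim φ ψ, by
      have (x y) (h : (∃ i j, x = Sum.inl i ∧ y = Sum.inl j ∧ (cycleGraph a).Adj i j) ∨
          (∃ i j, x = Sum.inr i ∧ y = Sum.inr j ∧ (cycleGraph b).Adj i j) ∨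
          (∃ (ha : 0 < a) (hb : 0 < b), x = Sum.inl ⟨0, ha⟩ ∧ y = Sum.inr ⟨0, hb⟩)) :
          G.Adj (Sum.elim φ ψ x) (Sum.elim φ ψ y) := by
        rcases h with ⟨i, j, rfl, rfl, h⟩ | ⟨i, j, rfl, rfl, h⟩ | ⟨_, _, rfl, rfl⟩
        · exact φ.map_adj h
        · exact ψ.map_adj h
        · exact huv
      rintro x y ⟨-, h | h⟩
      · exact this _ _ h
      · exact (this _ _ h).symm⟩
    obtain ⟨f⟩ := nonempty_iso_of_injective_of_degR_le hG Φ hinj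
      (degR_le_of_branch (x := .inl ⟨0, ha0⟩) (y := .inr ⟨0, hb0⟩) hinj
        hw hu hv (two_le_degR_twoCyclesEdge ha hb)
        (three_le_degR_twoCyclesEdge_inl ha hb) (three_le_degR_twoCyclesEdge_inr ha hb))
    refine ⟨a, b, ha, hb, ?_, ⟨f⟩⟩
    rw [Nat.card_congr f.toEquiv]
    simp

lemma isB1b_or_isB3b_of_not_adj (hG : G.Connected) (hne : u ≠ v) (huv : ¬ G.Adj u v)
    (hu : degR G u = 3) (hv : degR G v = 3) (hw : ∀ w, w ≠ u → w ≠ v → degR G w = 2) :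
    IsB1b (Nat.card V) G ∨ IsB3b (Nat.card V) G := by
  obtain ⟨p, hp⟩ := (hG.preconnected u v).exists_isPath
  have hlen0 : p.length ≠ 0 := fun h ↦ hne (Walk.eq_of_length_eq_zero h)
  have hlen1 : p.length ≠ 1 := fun h ↦ huv (p.adj_of_length_eq_one h)
  obtain ⟨k, hk, hpk⟩ : ∃ k, 0 < k ∧ p.length = k + 1 := ⟨p.length - 1, by omega, by omega⟩
  obtain ⟨a, ha, φ, hφ, hφ0, hφp, h⟩ := exists_cycles_of_isPath hp hne hu hv hw
    (fun h ↦ huv h.1)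
  have ha0 : 0 < a := by omega
  replace hφ0 : φ ⟨0, ha0⟩ = u := hφ0
  let π (j : Fin k) : V := p.getVert (j + 1)
  have hπ : Function.Injective π := fun i j h ↦ by
    have := hp.getVert_injOn (by simp; omega) (by simp; omega) h
    exact Fin.ext (by omega)
  have hstart (hk : 0 < k) : G.Adj u (π ⟨0, hk⟩) := by
    simpa using p.adj_getVert_succ (i := 0) (by omega)
  have hstep (i j : Fin k) (h : (j : ℕ) = i + 1) : G.Adj (π i) (π j) := by
    have := p.adj_getVert_succ (i := i + 1) (by omega)
    simpa only [π, h] using this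
  have hend (h : k - 1 < k) : G.Adj (π ⟨k - 1, h⟩) v := by
    have := p.adj_getVert_succ (i := k - 1 + 1) (by omega)
    rwa [show k - 1 + 1 + 1 = p.length by omega, p.getVert_length] at this
  rcases h with ⟨y, rfl, hy⟩ | ⟨b, hb, ψ, hψ, hψ0, hψp, hφψ⟩
  · right
    replace hy : ¬ (cycleGraph a).Adj ⟨0, ha0⟩ y := hy
    subst hφ0
    have hney : (⟨0, by omega⟩ : Fin a) ≠ y := fun h ↦ hne (congrArg φ h)
    have : Nonempty (Fin a ⊕ Fin k) := ⟨.inl y⟩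
    have hinj : Function.Injective (Sum.elim φ π) :=
      hφ.sumElim hπ fun i j ↦ hφp i _ (by omega) (by omega)
    let Φ : cyclePlusPath a k ⟨0, by omega⟩ y →g G := ⟨Sum.elim φ π, by
      have (z w) (h : (∃ i j, z = Sum.inl i ∧ w = Sum.inl j ∧ (cycleGraph a).Adj i j) ∨
          (∃ hk : 0 < k, z = Sum.inl ⟨0, by omega⟩ ∧ w = Sum.inr ⟨0, hk⟩) ∨
          (∃ i j : Fin k, z = Sum.inr i ∧ w = Sum.inr j ∧ (j : ℕ) = (i : ℕ) + 1) ∨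
          (∃ hk : 0 < k, z = Sum.inr ⟨k - 1, Nat.sub_lt hk Nat.one_pos⟩ ∧ w = Sum.inl y)) :
          G.Adj (Sum.elim φ π z) (Sum.elim φ π w) := by
        rcases h with ⟨i, j, rfl, rfl, h⟩ | ⟨_, rfl, rfl⟩ | ⟨i, j, rfl, rfl, h⟩ | ⟨_, rfl, rfl⟩
        · exact φ.map_adj h
        · exact hstart _
        · exact hstep i j h
        · exact hend _
      rintro x y ⟨-, h | h⟩
      · exact this _ _ h
      · exact (this _ _ h).symm⟩
    obtain ⟨f⟩ := nonempty_iso_of_injective_of_degR_le hG Φ hinj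
      (degR_le_of_branch (x := .inl ⟨0, ha0⟩) (y := .inl y) hinj
        hw hu hv (two_le_degR_cyclePlusPath ha hney)
        (three_le_degR_cyclePlusPath_start ha hk _ y)
        (three_le_degR_cyclePlusPath_end ha hk _ y))
    have hcard : Nat.card V = a + k := by rw [Nat.card_congr f.toEquiv]; simp
    obtain rfl : k = Nat.card V - a := by omega
    have ha4 : a ≠ 3 := by
      rintro rfl
      exact hy (by rw [cycleGraph_three_eq_top]; exact hney)
    exact ⟨a, _, y, by omega, by omega, hney, hy, ⟨f⟩⟩
  · left
    have hb0 : 0 < b := by omega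
    replace hψ0 : ψ ⟨0, hb0⟩ = v := hψ0
    subst hφ0 hψ0
    have : Nonempty ((Fin a ⊕ Fin b) ⊕ Fin k) := ⟨.inl (.inl ⟨0, by omega⟩)⟩
    have hinj : Function.Injective (Sum.elim (Sum.elim φ ψ) π) := by
      refine (hφ.sumElim hψ hφψ).sumElim hπ ?_
      rintro (i | i) j
      · exact hφp i _ (by omega) (by omega)
      · exact hψp i _ (by omega) (by omega)
    let Φ : twoCyclesPath a b k →g G := ⟨Sum.elim (Sum.elim φ ψ) π, by
      have (x y) (h : (∃ i j, x = Sum.inl (Sum.inl i) ∧ y = Sum.inl (Sum.inl j) ∧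
            (cycleGraph a).Adj i j) ∨
          (∃ i j, x = Sum.inl (Sum.inr i) ∧ y = Sum.inl (Sum.inr j) ∧
            (cycleGraph b).Adj i j) ∨
          (∃ (ha : 0 < a) (hk : 0 < k), x = Sum.inl (Sum.inl ⟨0, ha⟩) ∧ y = Sum.inr ⟨0, hk⟩) ∨
          (∃ i j : Fin k, x = Sum.inr i ∧ y = Sum.inr j ∧ (j : ℕ) = (i : ℕ) + 1) ∨
          (∃ (hb : 0 < b) (hk : 0 < k), x = Sum.inr ⟨k - 1, Nat.sub_lt hk Nat.one_pos⟩ ∧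
            y = Sum.inl (Sum.inr ⟨0, hb⟩))) :
          G.Adj (Sum.elim (Sum.elim φ ψ) π x) (Sum.elim (Sum.elim φ ψ) π y) := by
        rcases h with ⟨i, j, rfl, rfl, h⟩ | ⟨i, j, rfl, rfl, h⟩ | ⟨_, _, rfl, rfl⟩ |
          ⟨i, j, rfl, rfl, h⟩ | ⟨_, _, rfl, rfl⟩
        · exact φ.map_adj h
        · exact ψ.map_adj h
        · exact hstart _
        · exact hstep i j h
        · exact hend _
      rintro x y ⟨-, h | h⟩
      · exact this _ _ h
      · exact (this _ _ h).symm⟩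
    obtain ⟨f⟩ := nonempty_iso_of_injective_of_degR_le hG Φ hinj
      (degR_le_of_branch (x := .inl (.inl ⟨0, ha0⟩)) (y := .inl (.inr ⟨0, hb0⟩)) hinj
        hw hu hv (two_le_degR_twoCyclesPath ha hb)
        (three_le_degR_twoCyclesPath_left ha hk) (three_le_degR_twoCyclesPath_right hb hk))
    have hcard : Nat.card V = a + b + k := by rw [Nat.card_congr f.toEquiv]; simp
    refine ⟨a, b, ha, hb, by omega, ?_⟩
    rw [show Nat.card V - a - b = k by omega]
    exact ⟨f⟩

end Structure

section DoubleCounting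

variable {V : Type*} {G : SimpleGraph V}

lemma degR_eq_degree (v : V) [Fintype (G.neighborSet v)] : degR G v = G.degree v := by
  rw [degR, Set.ncard_eq_toFinset_card', Set.toFinset_card, card_neighborSet_eq_degree]

variable [Fintype V]

lemma sum_degR : ∑ v, degR G v = 2 * G.edgeSet.ncard := by
  classical
  simp only [degR_eq_degree]
  rw [sum_degrees_eq_twice_card_edges, ← coe_edgeFinset, Set.ncard_coe_finset]

lemma sum_sum_neighborFinset_eq_two_mul_sum [DecidableEq V] [DecidableRel G.Adj]
    (F : Sym2 V → ℝ) :
    ∑ v, ∑ w ∈ G.neighborFinset v, F s(v, w) = 2 * ∑ e ∈ G.edgeFinset, F e := by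
  have h1 : ∑ d : G.Dart, F d.edge = ∑ v, ∑ w ∈ G.neighborFinset v, F s(v, w) := by
    rw [← Finset.sum_fiberwise_of_maps_to (g := fun d : G.Dart ↦ d.fst) (t := Finset.univ)
      (fun _ _ ↦ Finset.mem_univ _)]
    refine Finset.sum_congr rfl fun v _ ↦ ?_
    rw [dart_fst_fiber, Finset.sum_image fun x _ y _ h ↦ G.dartOfNeighborSet_injective v h,
      neighborFinset, Set.toFinset]
    simp [dartOfNeighborSet, Dart.edge]
  have h2 : ∑ d : G.Dart, F d.edge = ∑ e ∈ G.edgeFinset, 2 * F e := by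
    rw [← Finset.sum_fiberwise_of_maps_to (g := fun d : G.Dart ↦ d.edge) (t := G.edgeFinset)
      (fun d _ ↦ by simp)]
    refine Finset.sum_congr rfl fun e he ↦ ?_
    rw [Finset.sum_congr rfl (g := fun _ ↦ F e) (fun d hd ↦ by rw [(Finset.mem_filter.mp hd).2]),
      Finset.sum_const, G.dart_edge_fiber_card e (by simpa using he)]
    simp
  rw [← h1, h2, Finset.mul_sum]

lemma two_mul_sumConn [DecidableEq V] [DecidableRel G.Adj] :
    2 * sumConn G = ∑ v, ∑ w ∈ G.neighborFinset v,
      1 / Real.sqrt ((degR G v : ℝ) + (degR G w : ℝ)) := by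
  have : G.edgeSet.toFinite.toFinset = G.edgeFinset := by ext; simp
  rw [sumConn, this, ← sum_sum_neighborFinset_eq_two_mul_sum]
  simp

lemma sum_sum_neighborFinset_swap [DecidableRel G.Adj] (T : V → V → ℝ) :
    ∑ v, ∑ w ∈ G.neighborFinset v, T w v = ∑ v, ∑ w ∈ G.neighborFinset v, T v w :=
  Finset.sum_comm' fun v w ↦ by simp [adj_comm]

lemma sum_sum_neighborFinset_half_add [DecidableEq V] [DecidableRel G.Adj] (T : V → V → ℝ) :
    ∑ v, ∑ w ∈ G.neighborFinset v, ((1 : ℝ) / 2 + T v w + T w v) =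
      G.edgeSet.ncard + 2 * ∑ v, ∑ w ∈ G.neighborFinset v, T v w := by
  have h := congrArg (Nat.cast : ℕ → ℝ) (sum_degR (G := G))
  push_cast at h
  simp only [Finset.sum_add_distrib, sum_sum_neighborFinset_swap T, Finset.sum_const,
    card_neighborFinset_eq_degree, nsmul_eq_mul, ← degR_eq_degree]
  rw [← Finset.sum_mul, h]
  ring

lemma sumConn_eq [DecidableEq V] [DecidableRel G.Adj] {T : V → V → ℝ}
    (hT : ∀ v w, G.Adj v w →
      1 / Real.sqrt ((degR G v : ℝ) + (degR G w : ℝ)) = 1 / 2 + T v w + T w v) :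
    sumConn G = G.edgeSet.ncard / 2 + ∑ v, ∑ w ∈ G.neighborFinset v, T v w := by
  have h := two_mul_sumConn (G := G)
  rw [Finset.sum_congr rfl fun v _ ↦ Finset.sum_congr rfl fun w hw ↦
    hT v w (by simpa using hw), sum_sum_neighborFinset_half_add] at h
  linarith

lemma sumConn_le {t : V → ℝ} (ht : ∀ v w, G.Adj v w →
      1 / Real.sqrt ((degR G v : ℝ) + (degR G w : ℝ)) ≤ 1 / 2 + t v + t w) :
    sumConn G ≤ G.edgeSet.ncard / 2 + ∑ v, degR G v * t v := by
  classical
  have h := two_mul_sumConn (G := G)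
  have h' := sum_sum_neighborFinset_half_add (G := G) fun v _ ↦ t v
  have hle : ∑ v, ∑ w ∈ G.neighborFinset v, 1 / Real.sqrt ((degR G v : ℝ) + (degR G w : ℝ)) ≤
      ∑ v, ∑ w ∈ G.neighborFinset v, (1 / 2 + t v + t w) :=
    Finset.sum_le_sum fun v _ ↦ Finset.sum_le_sum fun w hw ↦ ht v w (by simpa using hw)
  simp only [Finset.sum_const, card_neighborFinset_eq_degree, nsmul_eq_mul,
    ← degR_eq_degree] at h'
  linarith

end DoubleCounting

section Numerics

lemma one_div_sqrt_five_mem : (0.4472 : ℝ) < 1 / √5 ∧ 1 / √5 < (0.44722 : ℝ) := by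
  have h0 : (0 : ℝ) < √5 := by positivity
  rw [lt_div_iff₀ h0, div_lt_iff₀ h0]
  have h := Real.sq_sqrt (show (0 : ℝ) ≤ 5 by norm_num)
  constructor <;> nlinarith

lemma one_div_sqrt_six_mem : (0.4082 : ℝ) < 1 / √6 ∧ 1 / √6 < (0.40826 : ℝ) := by
  have h0 : (0 : ℝ) < √6 := by positivity
  rw [lt_div_iff₀ h0, div_lt_iff₀ h0]
  have h := Real.sq_sqrt (show (0 : ℝ) ≤ 6 by norm_num)
  constructor <;> nlinarith

lemma one_div_sqrt_le {s c : ℝ} (hc : 0 < c) (h : 1 ≤ c ^ 2 * s) : 1 / √s ≤ c := by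
  have hs : 0 < s := by
    by_contra! hs
    nlinarith [mul_nonneg (sq_nonneg c) (neg_nonneg.mpr hs)]
  rw [div_le_iff₀ (Real.sqrt_pos.mpr hs), ← Real.sqrt_sq hc.le, ← Real.sqrt_mul (sq_nonneg c)]
  exact Real.one_le_sqrt.mpr h

lemma one_div_sqrt_four : 1 / √(4 : ℝ) = 1 / 2 := by
  rw [show (4 : ℝ) = 2 ^ 2 by norm_num, Real.sqrt_sq (by norm_num)]

/-- Vertex weights whose sum over the two ends of an edge bounds the deviation of the weight of
the edge from `1 / 2`. -/
noncomputable def endWeight (d : ℕ) : ℝ := if d = 1 then 0.078 else -0.135 * (1 - 2 / d)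

lemma one_div_sqrt_le_endWeight_one {y : ℕ} (hy : 2 ≤ y) :
    1 / √((1 : ℝ) + y) ≤ 1 / 2 + 0.078 + endWeight y := by
  rw [endWeight, if_neg (by omega)]
  obtain rfl | rfl | hy : y = 2 ∨ y = 3 ∨ 4 ≤ y := by omega
  · refine (one_div_sqrt_le (c := 0.578) ?_ ?_).trans ?_ <;> norm_num
  · refine (one_div_sqrt_le (c := 0.5) ?_ ?_).trans ?_ <;> norm_num
  · have hy' : (4 : ℝ) ≤ y := by exact_mod_cast hy
    have h1 : 0 < 2 / (y : ℝ) := by positivity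
    obtain rfl | hy : y = 4 ∨ 5 ≤ y := by omega
    · refine (one_div_sqrt_le (c := 0.45) ?_ ?_).trans ?_ <;> norm_num
    · have hy' : (5 : ℝ) ≤ y := by exact_mod_cast hy
      refine (one_div_sqrt_le (c := 0.443) (by norm_num) (by linarith)).trans (by linarith)

lemma one_div_sqrt_le_endWeight {x y : ℕ} (hx : 2 ≤ x) (hy : 2 ≤ y) :
    1 / √((x : ℝ) + y) ≤ 1 / 2 + endWeight x + endWeight y := by
  rw [endWeight, endWeight, if_neg (by omega), if_neg (by omega)]
  obtain ⟨rfl, rfl⟩ | ⟨rfl, rfl⟩ | ⟨rfl, rfl⟩ | h :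
      (x = 2 ∧ y = 2) ∨ (x = 2 ∧ y = 3) ∨ (x = 3 ∧ y = 2) ∨ 6 ≤ x + y := by omega
  · refine (one_div_sqrt_le (c := 0.5) ?_ ?_).trans ?_ <;> norm_num
  · refine (one_div_sqrt_le (c := 0.455) ?_ ?_).trans ?_ <;> norm_num
  · refine (one_div_sqrt_le (c := 0.455) ?_ ?_).trans ?_ <;> norm_num
  · have hx' : (2 : ℝ) ≤ x := by exact_mod_cast hx
    have hy' : (2 : ℝ) ≤ y := by exact_mod_cast hy
    have hs : (6 : ℝ) ≤ x + y := by exact_mod_cast h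
    have hharm : 4 / ((x : ℝ) + y) ≤ 1 / x + 1 / y := by
      rw [div_add_div _ _ (by positivity) (by positivity), div_le_div_iff₀ (by positivity)
        (by positivity)]
      nlinarith [sq_nonneg ((x : ℝ) - y)]
    have hq : 1 / √((x : ℝ) + y) ≤ 0.42 :=
      one_div_sqrt_le (by norm_num) (by linarith)
    have hq2 : (1 / √((x : ℝ) + y)) ^ 2 = 1 / ((x : ℝ) + y) := by
      rw [div_pow, Real.sq_sqrt (by positivity), one_pow]
    have hq3 : 4 / ((x : ℝ) + y) = 4 * (1 / √((x : ℝ) + y)) ^ 2 := by rw [hq2]; ring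
    have e1 : 2 / (x : ℝ) = 2 * (1 / x) := by ring
    have e2 : 2 / (y : ℝ) = 2 * (1 / y) := by ring
    rw [e1, e2]
    nlinarith

lemma mul_endWeight_le {d : ℕ} (hd : 1 ≤ d) : d * endWeight d ≤ -0.135 * (d - 2) := by
  rw [endWeight]
  split_ifs with h
  · subst h; norm_num
  · have : (d : ℝ) ≠ 0 := by positivity
    field_simp
    norm_num

end Numerics

section Bicyclic

variable {V : Type*} [Fintype V] {G : SimpleGraph V}

lemma one_le_degR (hG : G.Connected) (hV : 2 ≤ Fintype.card V) (v : V) : 1 ≤ degR G v := by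
  classical
  have : Nontrivial V := Fintype.one_lt_card_iff_nontrivial.mp hV
  rw [degR_eq_degree]
  exact hG.preconnected.degree_pos_of_nontrivial v

lemma not_degR_eq_one_of_adj (hG : G.Connected) (hV : 3 ≤ Fintype.card V) {v w : V}
    (h : G.Adj v w) : ¬ (degR G v = 1 ∧ degR G w = 1) := by
  rintro ⟨hv, hw⟩
  let φ : (⊤ : SimpleGraph Bool) →g G := ⟨fun b ↦ cond b v w, by
    rintro (_ | _) (_ | _) hab
    · exact absurd rfl hab
    · exact h.symm
    · exact h
    · exact absurd rfl hab⟩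
  have hφ : Function.Injective φ := by
    rintro (_ | _) (_ | _) hab
    · rfl
    · exact absurd hab.symm h.ne
    · exact absurd hab h.ne
    · rfl
  obtain ⟨f⟩ := nonempty_iso_of_injective_of_degR_le hG φ hφ (by
    rintro b
    have h1 : degR (⊤ : SimpleGraph Bool) b = 1 := by
      rw [degR_eq_degree]; revert b; decide
    rw [h1]
    cases b
    · exact hw.le
    · exact hv.le)
  rw [Fintype.card_congr f.toEquiv] at hV
  simp at hV

lemma sumConn_lt_of_leaf (hG : G.Connected) (hV : 3 ≤ Fintype.card V)
    (hE : G.edgeSet.ncard = Fintype.card V + 1) {u : V} (hu : degR G u = 1) :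
    sumConn G < ((Fintype.card V : ℝ) - 5) / 2 + 6 / √5 := by
  classical
  have hpos := one_le_degR hG (by omega)
  have hle := sumConn_le (G := G) (t := fun v ↦ endWeight (degR G v)) fun v w h ↦ by
    have hvw := not_degR_eq_one_of_adj hG hV h
    have hv := hpos v
    have hw := hpos w
    by_cases hv1 : degR G v = 1
    · simpa [hv1, endWeight] using one_div_sqrt_le_endWeight_one (y := degR G w) (by omega)
    by_cases hw1 : degR G w = 1
    · rw [add_comm, add_right_comm]
      simpa [hw1, endWeight] using one_div_sqrt_le_endWeight_one (y := degR G v) (by omega)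
    exact one_div_sqrt_le_endWeight (by omega) (by omega)
  have hsum : ∑ v, (degR G v : ℝ) * endWeight (degR G v) ≤
      ∑ v, (-0.135 * ((degR G v : ℝ) - 2) - if v = u then 0.057 else 0) := by
    refine Finset.sum_le_sum fun v _ ↦ ?_
    split_ifs with h
    · rw [h, hu, endWeight]; norm_num
    · simpa using mul_endWeight_le (hpos v)
  have hdeg := congrArg (Nat.cast : ℕ → ℝ) (sum_degR (G := G))
  push_cast [hE] at hdeg
  rw [Finset.sum_sub_distrib, Finset.sum_ite_eq' Finset.univ u, ← Finset.mul_sum,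
    Finset.sum_sub_distrib, hdeg, if_pos (Finset.mem_univ u), Finset.sum_const,
    Finset.card_univ, nsmul_eq_mul] at hsum
  rw [hE] at hle
  push_cast at hle
  have h5 := one_div_sqrt_five_mem.1
  have h6 : 6 / √(5 : ℝ) = 6 * (1 / √5) := by ring
  linarith

lemma sumConn_lt_of_degR_eq_four (hE : G.edgeSet.ncard = Fintype.card V + 1) {u : V}
    (hu : degR G u = 4) (hw : ∀ w, w ≠ u → degR G w = 2) :
    sumConn G < ((Fintype.card V : ℝ) - 5) / 2 + 6 / √5 := by
  classical
  have hle := sumConn_le (G := G) (t := fun v ↦ if v = u then 1 / √6 - 1 / 2 else 0)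
    fun v w h ↦ by
      by_cases hvu : v = u
      · have hwu : w ≠ u := fun h' ↦ h.ne (hvu.trans h'.symm)
        simp only [if_neg hwu, hvu, hu, hw w hwu]
        norm_num
      by_cases hwu : w = u
      · simp only [if_neg hvu, hwu, hu, hw v hvu]
        norm_num
      simp only [if_neg hvu, if_neg hwu, hw v hvu, hw w hwu]
      norm_num [one_div_sqrt_four]
  simp only [mul_ite, mul_zero, Finset.sum_ite_eq', Finset.mem_univ, if_true, hu, hE] at hle
  push_cast at hle
  have h5 := one_div_sqrt_five_mem.1
  have h6 := one_div_sqrt_six_mem.2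
  have h6' : 6 / √(5 : ℝ) = 6 * (1 / √5) := by ring
  linarith

lemma sumConn_eq_of_two_branch [DecidableRel G.Adj] (hE : G.edgeSet.ncard = Fintype.card V + 1)
    {u v : V} (huv : u ≠ v) (hu : degR G u = 3) (hv : degR G v = 3)
    (hw : ∀ w, w ≠ u → w ≠ v → degR G w = 2) :
    sumConn G = ((Fintype.card V : ℝ) - 5) / 2 + 6 / √5 +
      if G.Adj u v then 1 / √6 + 1 / 2 - 2 / √5 else 0 := by
  classical
  set y : ℝ := 1 / √5 - 1 / 2
  set z : ℝ := (1 / √6 - 1 / 2) / 2 - y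
  have e2 (a : V) (h1 : a ≠ u) (h2 : a ≠ v) : (degR G a : ℝ) = 2 := by rw [hw a h1 h2]; rfl
  have e3 : (degR G u : ℝ) = 3 := by rw [hu]; rfl
  have e4 : (degR G v : ℝ) = 3 := by rw [hv]; rfl
  have h := sumConn_eq (G := G) (T := fun a b ↦ (if a = u then y + if b = v then z else 0 else 0) +
    if a = v then y + if b = u then z else 0 else 0) fun a b hab ↦ by
      have hne := hab.ne
      by_cases hau : a = u
      · subst hau
        by_cases hbv : b = v
        · subst hbv
          simp only [e3, e4, if_true, if_neg huv, if_neg huv.symm]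
          norm_num [z]; ring
        · simp only [e3, e2 b hne.symm hbv, if_true, if_neg huv, if_neg hbv, if_neg hne.symm]
          norm_num [y]
      by_cases hav : a = v
      · subst hav
        by_cases hbu : b = u
        · subst hbu
          simp only [e3, e4, if_true, if_neg huv, if_neg huv.symm]
          norm_num [z]; ring
        · simp only [e4, e2 b hbu hne.symm, if_true, if_neg hau, if_neg hbu, if_neg hne.symm]
          norm_num [y]
      simp only [e2 a hau hav, if_neg hau, if_neg hav]
      by_cases hbu : b = u
      · subst hbu
        simp only [e3, if_true, if_neg huv]
        norm_num [y]
      by_cases hbv : b = v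
      · subst hbv
        simp only [e4, if_true, if_neg hbu]
        norm_num [y]
      simp only [e2 b hbu hbv, if_neg hbu, if_neg hbv]
      norm_num [one_div_sqrt_four]
  have hinner (a b : V) : ∑ w ∈ G.neighborFinset a, (y + if w = b then z else 0) =
      degR G a * y + if G.Adj a b then z else 0 := by
    rw [Finset.sum_add_distrib, Finset.sum_const, Finset.sum_ite_eq',
      card_neighborFinset_eq_degree, ← degR_eq_degree, nsmul_eq_mul]
    simp
  have houter (a b : V) : ∑ c, ∑ w ∈ G.neighborFinset c,
      (if c = a then y + if w = b then z else 0 else 0) =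
      degR G a * y + if G.Adj a b then z else 0 := by
    rw [Finset.sum_eq_single a (fun c _ hc ↦ by simp [hc]) (by simp), ← hinner]
    simp
  simp only [Finset.sum_add_distrib (f := fun _ ↦ ite _ _ _)] at h
  rw [Finset.sum_add_distrib, houter, houter, e3, e4, hE] at h
  simp only [G.adj_comm v u] at h
  rw [h]
  push_cast
  split_ifs <;> simp only [z, y] <;> ring

lemma exists_of_sum_eq_two {f : V → ℕ} (hf : ∑ v, f v = 2) :
    (∃ u, f u = 2 ∧ ∀ w, w ≠ u → f w = 0) ∨
      ∃ u v, u ≠ v ∧ f u = 1 ∧ f v = 1 ∧ ∀ w, w ≠ u → w ≠ v → f w = 0 := by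
  classical
  obtain ⟨u, -, hu⟩ := Finset.exists_ne_zero_of_sum_ne_zero (hf.trans_ne two_ne_zero)
  rw [← Finset.add_sum_erase _ _ (Finset.mem_univ u)] at hf
  obtain hu | hu : f u = 2 ∨ f u = 1 := by omega
  · refine .inl ⟨u, hu, fun w hw ↦ ?_⟩
    have h0 : ∑ w ∈ Finset.univ.erase u, f w = 0 := by omega
    exact Finset.sum_eq_zero_iff.mp h0 w (by simpa)
  · have h1 : ∑ w ∈ Finset.univ.erase u, f w = 1 := by omega
    obtain ⟨v, hv, hv0⟩ := Finset.exists_ne_zero_of_sum_ne_zero (h1.trans_ne one_ne_zero)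
    rw [← Finset.add_sum_erase _ _ hv] at h1
    have h0 : ∑ w ∈ (Finset.univ.erase u).erase v, f w = 0 := by omega
    refine .inr ⟨u, v, (Finset.ne_of_mem_erase hv).symm, hu, by omega, fun w hwu hwv ↦ ?_⟩
    exact Finset.sum_eq_zero_iff.mp h0 w (by simp [hwu, hwv])

/-- The possible degree sequences of a bicyclic graph without leaves. -/
lemma bicyclic_degR_cases (hE : G.edgeSet.ncard = Fintype.card V + 1) (h2 : ∀ w, 2 ≤ degR G w) :
    (∃ u, degR G u = 4 ∧ ∀ w, w ≠ u → degR G w = 2) ∨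
      ∃ u v, u ≠ v ∧ degR G u = 3 ∧ degR G v = 3 ∧ ∀ w, w ≠ u → w ≠ v → degR G w = 2 := by
  have hsum : ∑ v, (degR G v - 2) = 2 := by
    have h : ∑ v, (degR G v - 2 + 2) = 2 * G.edgeSet.ncard := by
      rw [← sum_degR]
      exact Finset.sum_congr rfl fun v _ ↦ Nat.sub_add_cancel (h2 v)
    rw [Finset.sum_add_distrib, Finset.sum_const, Finset.card_univ, smul_eq_mul, hE] at h
    omega
  rcases exists_of_sum_eq_two hsum with ⟨u, hu, hw⟩ | ⟨u, v, huv, hu, hv, hw⟩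
  · refine .inl ⟨u, by omega, fun w h ↦ ?_⟩
    have := hw w h
    have := h2 w
    omega
  · refine .inr ⟨u, v, huv, by omega, by omega, fun w hwu hwv ↦ ?_⟩
    have := hw w hwu hwv
    have := h2 w
    omega

end Bicyclic

/-- Let `n ≥ 7` and let `G` be a bicyclic graph with `n` vertices. Then
`χ(G) ≤ (n−4)/2 + 1/√6 + 4/√5`, with equality iff `G` is obtained either by joining
two vertex-disjoint cycles `C_a`, `C_b` with `a + b = n` by an edge, or from the
cycle `C_n` by adding an edge; moreover, if `G` is of neither of these forms, then
`χ(G) ≤ (n−5)/2 + 6/√5`, with equality iff `G` is obtained either by joining two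
vertex-disjoint cycles `C_a`, `C_b` with `a + b < n` by a path of length
`n − a − b + 1`, or by joining two non-adjacent vertices of a cycle `C_a` with
`4 ≤ a ≤ n−1` by a path of length `n − a + 1`. -/
theorem stmt_18 {V : Type*} [Fintype V] (G : SimpleGraph V) (n : ℕ) (hn : 7 ≤ n)
    (hcard : Fintype.card V = n) (hconn : G.Connected)
    (hedges : G.edgeSet.ncard = n + 1) :
    (sumConn G ≤ ((n : ℝ) - 4) / 2 + 1 / Real.sqrt 6 + 4 / Real.sqrt 5 ∧
      (sumConn G = ((n : ℝ) - 4) / 2 + 1 / Real.sqrt 6 + 4 / Real.sqrt 5 ↔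
        IsB1a n G ∨ IsB3a n G)) ∧
    (¬ (IsB1a n G ∨ IsB3a n G) →
      sumConn G ≤ ((n : ℝ) - 5) / 2 + 6 / Real.sqrt 5 ∧
      (sumConn G = ((n : ℝ) - 5) / 2 + 6 / Real.sqrt 5 ↔ IsB1b n G ∨ IsB3b n G)) := by
  classical
  subst hcard
  have key : ((Fintype.card V : ℝ) - 5) / 2 + 6 / √5 + (1 / √6 + 1 / 2 - 2 / √5) =
      ((Fintype.card V : ℝ) - 4) / 2 + 1 / √6 + 4 / √5 := by ring
  have hgap : 0 < 1 / √(6 : ℝ) + 1 / 2 - 2 / √5 := by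
    have h5 := one_div_sqrt_five_mem.2
    have h6 := one_div_sqrt_six_mem.1
    have : 2 / √(5 : ℝ) = 2 * (1 / √5) := by ring
    linarith
  have strict (hlt : sumConn G < ((Fintype.card V : ℝ) - 5) / 2 + 6 / √5)
      (hno : ¬ ∃ u v, u ≠ v ∧ (∀ w, 2 ≤ degR G w) ∧ 3 ≤ degR G u ∧ 3 ≤ degR G v) :
      (sumConn G ≤ ((Fintype.card V : ℝ) - 4) / 2 + 1 / √6 + 4 / √5 ∧
        (sumConn G = ((Fintype.card V : ℝ) - 4) / 2 + 1 / √6 + 4 / √5 ↔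
          IsB1a (Fintype.card V) G ∨ IsB3a (Fintype.card V) G)) ∧
      (¬ (IsB1a (Fintype.card V) G ∨ IsB3a (Fintype.card V) G) →
        sumConn G ≤ ((Fintype.card V : ℝ) - 5) / 2 + 6 / √5 ∧
        (sumConn G = ((Fintype.card V : ℝ) - 5) / 2 + 6 / √5 ↔
          IsB1b (Fintype.card V) G ∨ IsB3b (Fintype.card V) G)) := by
    refine ⟨⟨by linarith, fun h ↦ by linarith, fun h ↦ ?_⟩, fun _ ↦ ⟨hlt.le,
      fun h ↦ absurd h hlt.ne, fun h ↦ ?_⟩⟩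
    · obtain ⟨u, v, -, h⟩ := exists_adj_branch_of_isB1a_or_isB3a (by omega) h
      exact absurd ⟨u, v, h⟩ hno
    · obtain ⟨u, v, -, h⟩ := exists_not_adj_branch_of_isB1b_or_isB3b (by omega) h
      exact absurd ⟨u, v, h⟩ hno
  by_cases h2 : ∀ w, 2 ≤ degR G w
  swap
  · push Not at h2
    obtain ⟨u, hu⟩ := h2
    have := one_le_degR hconn (by omega) u
    refine strict (sumConn_lt_of_leaf hconn (by omega) hedges (u := u) (by omega)) ?_
    rintro ⟨-, -, -, h, -⟩
    have := h u
    omega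
  rcases bicyclic_degR_cases hedges h2 with ⟨u, hu, hw⟩ | ⟨u, v, huv, hu, hv, hw⟩
  · refine strict (sumConn_lt_of_degR_eq_four hedges hu hw) ?_
    rintro ⟨x, y, hxy, -, hx, hy⟩
    have hxu : x = u := by
      by_contra h
      have := hw x h
      omega
    have hyu : y = u := by
      by_contra h
      have := hw y h
      omega
    exact hxy (hxu.trans hyu.symm)
  have hval := sumConn_eq_of_two_branch hedges huv hu hv hw
  have hbranch (x : V) (hx : 3 ≤ degR G x) : x = u ∨ x = v := by
    by_contra! h
    have := hw x h.1 h.2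
    omega
  have hadj_iff {x y : V} (hxy : x ≠ y) (hx : 3 ≤ degR G x) (hy : 3 ≤ degR G y) :
      G.Adj x y ↔ G.Adj u v := by
    rcases hbranch x hx with rfl | rfl <;> rcases hbranch y hy with rfl | rfl
    · exact absurd rfl hxy
    · rfl
    · exact G.adj_comm _ _
    · exact absurd rfl hxy
  by_cases hadj : G.Adj u v
  · rw [if_pos hadj, key] at hval
    have hB := isB1a_or_isB3a_of_adj hconn hadj hu hv hw
    rw [Nat.card_eq_fintype_card] at hB
    exact ⟨⟨hval.le, fun _ ↦ hB, fun _ ↦ hval⟩, fun h ↦ absurd hB h⟩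
  · rw [if_neg hadj, add_zero] at hval
    have hB := isB1b_or_isB3b_of_not_adj hconn huv hadj hu hv hw
    rw [Nat.card_eq_fintype_card] at hB
    refine ⟨⟨by linarith, fun h ↦ by linarith, fun h ↦ ?_⟩,
      fun _ ↦ ⟨hval.le, fun _ ↦ hB, fun _ ↦ hval⟩⟩
    obtain ⟨x, y, hxy, hne, -, hx, hy⟩ := exists_adj_branch_of_isB1a_or_isB3a (by omega) h
    exact absurd ((hadj_iff hne hx hy).mp hxy) hadj
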